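/- arXiv:0804.4436 — 6 statements merged into one kernel-verified Lean document; each statement's English description precedes it below -/
import Mathlib

section
/- Let N ≥ 1 be a finite integer, let X_1, ..., X_N be distinct points of ℝ² with 0 < |X_k| < 1 for every k, and let m_1, ..., m_N be real numbers. Define Ψ_k(X) = ln(|X| / |X − X_k|). If V(X) = Σ_{k=1}^{N} m_k Ψ_k(X) satisfies V(X) = 0 for every X ∈ ℝ² with |X| ≥ 1, then m_k = 0 for every k. -/
open Filter Topology

/-- Uniqueness of point-mass (logarithmic potential) expansions in `ℝ²`:
if `V(X) = Σ m_k ln(‖X‖ / ‖X - X_k‖)` vanishes for all `‖X‖ ≥ 1`, then all `m_k = 0`. -/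
theorem point_mass_expansion_unique_R2 (N : ℕ) (hN : 1 ≤ N)
    (X : Fin N → EuclideanSpace ℝ (Fin 2)) (hX : Function.Injective X)
    (hX1 : ∀ k, 0 < ‖X k‖ ∧ ‖X k‖ < 1)
    (m : Fin N → ℝ)
    (h : ∀ Y : EuclideanSpace ℝ (Fin 2), 1 ≤ ‖Y‖ →
      ∑ k, m k * Real.log (‖Y‖ / ‖Y - X k‖) = 0) :
    ∀ k, m k = 0 := by
  set S : Set (EuclideanSpace ℝ (Fin 2)) := insert 0 (Set.range X) with hS
  have hSf : S.Finite := (Set.finite_range X).insert 0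
  have hconn : IsPreconnected Sᶜ := by
    apply (Set.Countable.isPathConnected_compl_of_one_lt_rank _ hSf.countable).isConnected.isPreconnected
    rw [← Module.finrank_eq_rank]
    simp
  have hlog : ∀ a Y : EuclideanSpace ℝ (Fin 2), Y ≠ a →
      AnalyticAt ℝ (fun Y => Real.log (‖Y - a‖ ^ 2)) Y := by
    intro a Y hY
    have h1 : ContDiffAt ℝ ⊤ (fun Y : EuclideanSpace ℝ (Fin 2) => ‖Y - a‖ ^ 2) Y :=
      ((contDiff_id.sub contDiff_const).norm_sq ℝ).contDiffAt
    have h2 := h1.log (by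
      have : ‖Y - a‖ ≠ 0 := by simpa [sub_eq_zero] using hY
      positivity)
    exact h2.analyticAt
  set f : EuclideanSpace ℝ (Fin 2) → ℝ := fun Y =>
    ∑ k, m k * (Real.log (‖Y - 0‖ ^ 2) - Real.log (‖Y - X k‖ ^ 2)) with hf
  have hfan : AnalyticOnNhd ℝ f Sᶜ := by
    intro Y hY
    have hY0 : Y ≠ 0 := fun e => hY (by simp [hS, e])
    have hYk : ∀ k, Y ≠ X k := fun k e => hY (by simp [hS, e])
    apply Finset.analyticAt_fun_sum
    intro k _
    exact analyticAt_const.mul ((hlog 0 Y hY0).sub (hlog (X k) Y (hYk k)))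
  have hout : ∀ Y : EuclideanSpace ℝ (Fin 2), 1 ≤ ‖Y‖ → f Y = 0 := by
    intro Y hY
    have h0 := h Y hY
    have : f Y = 2 * ∑ k, m k * Real.log (‖Y‖ / ‖Y - X k‖) := by
      rw [hf, Finset.mul_sum]
      refine Finset.sum_congr rfl fun k _ => ?_
      have hne : ‖Y - X k‖ ≠ 0 := by
        rw [norm_ne_zero_iff, sub_ne_zero]
        rintro rfl
        linarith [(hX1 k).2]
      rw [Real.log_div (by linarith) hne, Real.log_pow, Real.log_pow, sub_zero]
      push_cast
      ring
    rw [this, h0, mul_zero]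
  have hzero : Set.EqOn f 0 Sᶜ := by
    let P : EuclideanSpace ℝ (Fin 2) := EuclideanSpace.single 0 2
    have hP : ‖P‖ = 2 := by simp [P]
    refine hfan.eqOn_zero_of_preconnected_of_eventuallyEq_zero hconn (z₀ := P) ?_ ?_
    · rintro (e | ⟨k, e⟩)
      · rw [e] at hP; simp at hP
      · rw [← e] at hP; linarith [(hX1 k).2]
    · have : ∀ᶠ Y in 𝓝 P, 1 < ‖Y‖ :=
        continuous_norm.continuousAt.eventually (lt_mem_nhds (by simp only [hP]; norm_num))
      filter_upwards [this] with Y hY using hout Y hY.le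
  intro k
  by_contra hk
  -- near `X k`, only the `k`-th logarithm blows up
  set g : EuclideanSpace ℝ (Fin 2) → ℝ := fun Y =>
    m k * Real.log (‖Y - 0‖ ^ 2) + ∑ j ∈ Finset.univ.erase k,
      m j * (Real.log (‖Y - 0‖ ^ 2) - Real.log (‖Y - X j‖ ^ 2)) with hg
  have hk0 : X k ≠ 0 := norm_pos_iff.1 (hX1 k).1
  have hgan : AnalyticAt ℝ g (X k) := by
    refine (analyticAt_const.mul (hlog 0 _ hk0)).add ?_
    apply Finset.analyticAt_fun_sum
    intro j hj
    have hjk : X k ≠ X j := fun e => (Finset.ne_of_mem_erase hj) (hX e).symm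
    exact analyticAt_const.mul ((hlog 0 _ hk0).sub (hlog (X j) _ hjk))
  have hfg : ∀ Y, f Y = g Y - m k * Real.log (‖Y - X k‖ ^ 2) := by
    intro Y
    simp only [hf, hg]
    rw [← Finset.add_sum_erase _ _ (Finset.mem_univ k)]
    ring
  have hev : ∀ᶠ Y in 𝓝[≠] (X k), Y ∈ Sᶜ := by
    have h1 : (S \ {X k})ᶜ ∈ 𝓝 (X k) :=
      (hSf.subset Set.sdiff_subset).isClosed.isOpen_compl.mem_nhds (by simp)
    filter_upwards [mem_nhdsWithin_of_mem_nhds h1, self_mem_nhdsWithin] with Y hY hY2 hYS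
    exact hY ⟨hYS, hY2⟩
  have hlim : Tendsto (fun Y => Real.log (‖Y - X k‖ ^ 2)) (𝓝[≠] (X k)) (𝓝 (g (X k) / m k)) := by
    have h1 : Tendsto (fun Y => g Y / m k) (𝓝[≠] (X k)) (𝓝 (g (X k) / m k)) :=
      (hgan.continuousAt.tendsto.mono_left nhdsWithin_le_nhds).div_const _
    refine h1.congr' ?_
    filter_upwards [hev] with Y hY
    have h2 : f Y = 0 := hzero hY
    rw [hfg] at h2
    rw [div_eq_iff hk]
    linarith
  have hbot : Tendsto (fun Y => Real.log (‖Y - X k‖ ^ 2)) (𝓝[≠] (X k)) atBot := by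
    refine Real.tendsto_log_nhdsNE_zero.comp ?_
    refine tendsto_nhdsWithin_iff.2 ⟨?_, ?_⟩
    · have : Continuous fun Y : EuclideanSpace ℝ (Fin 2) => ‖Y - X k‖ ^ 2 := by fun_prop
      simpa using (this.tendsto (X k)).mono_left nhdsWithin_le_nhds
    · filter_upwards [self_mem_nhdsWithin] with Y hY
      simpa [sub_eq_zero] using hY
  have : (𝓝[≠] (X k)).NeBot := Module.punctured_nhds_neBot ℝ _ _
  exact not_tendsto_nhds_of_tendsto_atBot hbot _ hlim
end

section
/- Let N ≥ 1 be a finite integer, let X_k = (x_k, y_k), k = 1, ..., N, be distinct points of ℝ² with 0 < |X_k| < 1, and let a_1, ..., a_N, b_1, ..., b_N be real numbers. Define the dipole basis functions 𝕄₁^[k](x, y) = −(x − x_k)/((x − x_k)² + (y − y_k)²) and 𝕄₂^[k](x, y) = −(y − y_k)/((x − x_k)² + (y − y_k)²). If Σ_{k=1}^{N} (a_k 𝕄₁^[k](x, y) + b_k 𝕄₂^[k](x, y)) = 0 for every (x, y) ∈ ℝ² with x² + y² ≥ 1, then a_k = 0 and b_k = 0 for every k. -/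
/-- Uniqueness of point-dipole expansions in `ℝ²`: if a finite linear combination of the
dipole basis functions `𝕄₁^[k](x,y) = -(x - x_k)/((x - x_k)² + (y - y_k)²)` and
`𝕄₂^[k](x,y) = -(y - y_k)/((x - x_k)² + (y - y_k)²)` vanishes for all `x² + y² ≥ 1`,
then all coefficients vanish. -/
theorem point_dipole_expansion_unique_R2 (N : ℕ) (hN : 1 ≤ N)
    (p : Fin N → ℝ × ℝ) (hp : Function.Injective p)
    (hp1 : ∀ k, 0 < (p k).1 ^ 2 + (p k).2 ^ 2 ∧ (p k).1 ^ 2 + (p k).2 ^ 2 < 1)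
    (a b : Fin N → ℝ)
    (h : ∀ x y : ℝ, 1 ≤ x ^ 2 + y ^ 2 →
      ∑ k, (a k * (-(x - (p k).1) / ((x - (p k).1) ^ 2 + (y - (p k).2) ^ 2))
          + b k * (-(y - (p k).2) / ((x - (p k).1) ^ 2 + (y - (p k).2) ^ 2))) = 0) :
    ∀ k, a k = 0 ∧ b k = 0 := by
  set q : Fin N → ℂ := fun k => ⟨(p k).1, (p k).2⟩ with hq
  set c : Fin N → ℂ := fun k => ⟨a k, b k⟩ with hc
  have hqinj : Function.Injective q := by
    intro i j hij
    apply hp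
    have h1 := congrArg Complex.re hij
    have h2 := congrArg Complex.im hij
    exact Prod.ext h1 h2
  have hout : ∀ z ∈ Metric.ball (3 : ℂ) 1, 2 < ‖z‖ := by
    intro z hz
    rw [Metric.mem_ball, dist_eq_norm] at hz
    have h3 : ‖(3 : ℂ)‖ ≤ ‖z‖ + ‖z - 3‖ := by
      have := norm_sub_le z (z - 3)
      simpa using this
    have h4 : ‖(3 : ℂ)‖ = 3 := by simp
    linarith
  have hqn : ∀ k, ‖q k‖ < 1 := by
    intro k
    have h1 := (hp1 k).2
    have h2 : ‖q k‖ ^ 2 = (p k).1 ^ 2 + (p k).2 ^ 2 := by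
      rw [Complex.sq_norm, Complex.normSq_apply]; simp only [hq]; ring
    nlinarith [norm_nonneg (q k)]
  have hne : ∀ z ∈ Metric.ball (3 : ℂ) 1, ∀ k, z - q k ≠ 0 := by
    intro z hz k h0
    have h1 := hout z hz
    rw [sub_eq_zero.mp h0] at h1
    linarith [hqn k]
  have hre : ∀ z ∈ Metric.ball (3 : ℂ) 1, (∑ k, c k / (z - q k)).re = 0 := by
    intro z hz
    have h1 : 1 ≤ z.re ^ 2 + z.im ^ 2 := by
      have h2 : ‖z‖ ^ 2 = z.re ^ 2 + z.im ^ 2 := by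
        rw [Complex.sq_norm, Complex.normSq_apply]; ring
      nlinarith [hout z hz]
    have h2 := h z.re z.im h1
    rw [Complex.re_sum, ← neg_eq_zero, ← Finset.sum_neg_distrib, ← h2]
    refine Finset.sum_congr rfl fun k _ => ?_
    rw [Complex.div_re, Complex.normSq_apply]
    simp only [hq, hc, Complex.sub_re, Complex.sub_im, ← pow_two]
    ring
  have han : AnalyticOnNhd ℂ (fun z => ∑ k, c k / (z - q k)) (Metric.ball (3 : ℂ) 1) := by
    apply DifferentiableOn.analyticOnNhd _ Metric.isOpen_ball
    refine DifferentiableOn.fun_sum fun k _ => ?_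
    exact (differentiableOn_const _).fun_div (by fun_prop) (fun z hz => hne z hz k)
  obtain ⟨C, hC⟩ : ∃ C, ∀ z ∈ Metric.ball (3 : ℂ) 1, ∑ k, c k / (z - q k) = C := by
    rcases han.is_constant_or_isOpen (convex_ball (3 : ℂ) 1).isPreconnected with h1 | h1
    · exact h1
    · exfalso
      have h2 := h1 _ subset_rfl Metric.isOpen_ball
      have h3 : (3 : ℂ) ∈ Metric.ball (3 : ℂ) 1 := Metric.mem_ball_self one_pos
      obtain ⟨e, he, h4⟩ := Metric.isOpen_iff.mp h2 _ (Set.mem_image_of_mem _ h3)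
      have h5 := hre 3 h3
      obtain ⟨w, hw, hw2⟩ := h4 (show (∑ k, c k / ((3 : ℂ) - q k)) + ((e / 2 : ℝ) : ℂ) ∈ _ by
        rw [Metric.mem_ball, dist_eq_norm, add_sub_cancel_left, Complex.norm_real,
          Real.norm_eq_abs, abs_of_pos (by linarith)]
        linarith)
      have h6 := congrArg Complex.re hw2
      rw [Complex.add_re, h5, hre w hw, Complex.ofReal_re] at h6
      linarith
  have hpoly : (∑ k, Polynomial.C (c k) * ∏ j ∈ Finset.univ.erase k,
        (Polynomial.X - Polynomial.C (q j)))
      = Polynomial.C C * ∏ j, (Polynomial.X - Polynomial.C (q j)) := by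
    apply Polynomial.eq_of_infinite_eval_eq
    have hinf : (Metric.ball (3 : ℂ) 1).Infinite :=
      infinite_of_mem_nhds (3 : ℂ) (Metric.ball_mem_nhds _ one_pos)
    refine hinf.mono fun z hz => ?_
    simp only [Set.mem_setOf_eq, Polynomial.eval_finset_sum, Polynomial.eval_mul,
      Polynomial.eval_C, Polynomial.eval_prod, Polynomial.eval_sub, Polynomial.eval_X]
    rw [← hC z hz, Finset.sum_mul]
    refine Finset.sum_congr rfl fun k _ => ?_
    rw [← Finset.mul_prod_erase Finset.univ (fun j => z - q j) (Finset.mem_univ k)]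
    have := hne z hz k
    field_simp
  intro k
  have hk := congrArg (Polynomial.eval (q k)) hpoly
  simp only [Polynomial.eval_finset_sum, Polynomial.eval_mul,
      Polynomial.eval_C, Polynomial.eval_prod, Polynomial.eval_sub, Polynomial.eval_X] at hk
  rw [Finset.prod_eq_zero (Finset.mem_univ k) (sub_self _), mul_zero,
    Finset.sum_eq_single k] at hk
  · have h7 : c k = 0 := by
      rcases mul_eq_zero.mp hk with h8 | h8
      · exact h8
      · exfalso
        obtain ⟨j, hj, hj2⟩ := Finset.prod_eq_zero_iff.mp h8
        exact (Finset.ne_of_mem_erase hj) (hqinj (sub_eq_zero.mp hj2)).symm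
    exact ⟨congrArg Complex.re h7, congrArg Complex.im h7⟩
  · intro i _ hik
    rw [Finset.prod_eq_zero (Finset.mem_erase.mpr ⟨hik.symm, Finset.mem_univ k⟩) (sub_self _),
      mul_zero]
  · intro hk2
    exact absurd (Finset.mem_univ k) hk2
end

section
/- Let N ≥ 1 be a finite integer, let X_k = (x_k, y_k), k = 1, ..., N, be distinct points of ℝ² with 0 < |X_k| < 1, and let a_1, ..., a_N, b_1, ..., b_N be real numbers. Define the second-order multipole basis functions 𝔸_k(X) = ((x − x_k)² − (y − y_k)²)/|X − X_k|⁴ and 𝔹_k(X) = 2(x − x_k)(y − y_k)/|X − X_k|⁴. If Σ_{k=1}^{N} (a_k 𝔸_k(X) + b_k 𝔹_k(X)) = 0 for every X = (x, y) ∈ ℝ² with |X| ≥ 1, then a_k = 0 and b_k = 0 for every k. -/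
/-- Uniqueness of second-order multipole (quadrupole) expansions in `ℝ²`: if a finite
linear combination of `𝔸_k(X) = ((x - x_k)² - (y - y_k)²)/‖X - X_k‖⁴` and
`𝔹_k(X) = 2(x - x_k)(y - y_k)/‖X - X_k‖⁴` vanishes for all `‖X‖ ≥ 1`, then all
coefficients vanish. -/
theorem quadrupole_expansion_unique_R2 (N : ℕ) (hN : 1 ≤ N)
    (p : Fin N → ℝ × ℝ) (hp : Function.Injective p)
    (hp1 : ∀ k, 0 < (p k).1 ^ 2 + (p k).2 ^ 2 ∧ (p k).1 ^ 2 + (p k).2 ^ 2 < 1)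
    (a b : Fin N → ℝ)
    (h : ∀ x y : ℝ, 1 ≤ x ^ 2 + y ^ 2 →
      ∑ k, (a k * (((x - (p k).1) ^ 2 - (y - (p k).2) ^ 2)
              / ((x - (p k).1) ^ 2 + (y - (p k).2) ^ 2) ^ 2)
          + b k * (2 * (x - (p k).1) * (y - (p k).2)
              / ((x - (p k).1) ^ 2 + (y - (p k).2) ^ 2) ^ 2)) = 0) :
    ∀ k, a k = 0 ∧ b k = 0 := by
  classical
  set w : Fin N → ℂ := fun k => ⟨(p k).1, (p k).2⟩ with hw
  set c : Fin N → ℂ := fun k => ⟨a k, b k⟩ with hc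
  set F : ℂ → ℂ := fun z => ∑ k, c k / (z - w k) ^ 2 with hF
  set U : Set ℂ := Metric.ball 3 1 with hU
  have hUn : ∀ z ∈ U, 1 ≤ z.re ^ 2 + z.im ^ 2 := by
    intro z hz
    have h1 : ‖z - 3‖ < 1 := by simpa [hU, dist_eq_norm] using hz
    have h2 := lt_of_le_of_lt (Complex.abs_re_le_norm (z - 3)) h1
    simp at h2
    rw [abs_lt] at h2
    nlinarith [sq_nonneg z.im]
  have hne : ∀ z ∈ U, ∀ k, z - w k ≠ 0 := by
    intro z hz k h0
    have h1 := hUn z hz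
    rw [sub_eq_zero.mp h0] at h1
    exact absurd h1 (not_le.mpr (hp1 k).2)
  have hre : ∀ z ∈ U, (F z).re = 0 := by
    intro z hz
    rw [← h z.re z.im (hUn z hz)]
    simp only [hF, Complex.re_sum]
    refine Finset.sum_congr rfl fun k _ => ?_
    have hn : (z.re - (p k).1) ^ 2 + (z.im - (p k).2) ^ 2 ≠ 0 := by
      intro h0
      apply hne z hz k
      apply Complex.ext <;> simp [hw] <;> nlinarith [sq_nonneg (z.re - (p k).1), sq_nonneg (z.im - (p k).2)]
    have hns : Complex.normSq ((z - w k) ^ 2)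
        = ((z.re - (p k).1) ^ 2 + (z.im - (p k).2) ^ 2) ^ 2 := by
      rw [map_pow, Complex.normSq_apply]; simp [hw]; ring
    rw [Complex.div_re, hns]
    simp only [hc, hw, pow_two, Complex.mul_re, Complex.mul_im, Complex.sub_re, Complex.sub_im]
    ring
  have hd : DifferentiableOn ℂ F U := by
    intro z hz
    apply DifferentiableAt.differentiableWithinAt
    simp only [hF]
    refine DifferentiableAt.fun_sum fun k _ => ?_
    exact (differentiableAt_const _).div (by fun_prop) (pow_ne_zero 2 (hne z hz k))
  have hconst : ∃ C, ∀ z ∈ U, F z = C := by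
    rcases (hd.analyticOnNhd Metric.isOpen_ball).is_constant_or_isOpen
      (convex_ball _ _).isPreconnected with h1 | h1
    · exact h1
    · exfalso
      have h2 := h1 U subset_rfl Metric.isOpen_ball
      have h3 : F 3 ∈ F '' U := ⟨3, Metric.mem_ball_self one_pos, rfl⟩
      obtain ⟨e, he, hs⟩ := Metric.isOpen_iff.mp h2 _ h3
      have h4 : F 3 + ((e / 2 : ℝ) : ℂ) ∈ Metric.ball (F 3) e := by
        rw [Metric.mem_ball, dist_eq_norm, add_sub_cancel_left, Complex.norm_real,
          Real.norm_of_nonneg (by positivity)]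
        linarith
      obtain ⟨z, hz, hz2⟩ := hs h4
      have h5 := congrArg Complex.re hz2
      rw [hre z hz, Complex.add_re, hre 3 (Metric.mem_ball_self one_pos), Complex.ofReal_re] at h5
      linarith
  obtain ⟨C, hC⟩ := hconst
  set Q : Polynomial ℂ :=
    ∑ k, Polynomial.C (c k) * ∏ j ∈ Finset.univ.erase k, (Polynomial.X - Polynomial.C (w j)) ^ 2
      - Polynomial.C C * ∏ j, (Polynomial.X - Polynomial.C (w j)) ^ 2 with hQ
  have hinf : U.Infinite := by
    apply infinite_of_mem_nhds (3 : ℂ)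
    exact Metric.ball_mem_nhds _ one_pos
  have hQ0 : Q = 0 := by
    apply Polynomial.eq_zero_of_infinite_isRoot
    refine hinf.mono fun z hz => ?_
    simp only [Set.mem_setOf_eq, Polynomial.IsRoot.def, hQ, Polynomial.eval_sub,
      Polynomial.eval_finset_sum, Polynomial.eval_mul, Polynomial.eval_C, Polynomial.eval_prod,
      Polynomial.eval_pow, Polynomial.eval_X]
    rw [← hC z hz, hF, Finset.sum_mul, sub_eq_zero]
    refine Finset.sum_congr rfl fun k _ => ?_
    rw [← Finset.mul_prod_erase Finset.univ _ (Finset.mem_univ k), ← mul_assoc,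
      div_mul_cancel₀ _ (pow_ne_zero 2 (hne z hz k))]
  have hwi : Function.Injective w := by
    intro i j hij
    apply hp
    have h1 := congrArg Complex.re hij
    have h2 := congrArg Complex.im hij
    exact Prod.ext h1 h2
  intro k
  have hk := congrArg (Polynomial.eval (w k)) hQ0
  simp only [hQ, Polynomial.eval_sub,
      Polynomial.eval_finset_sum, Polynomial.eval_mul, Polynomial.eval_C, Polynomial.eval_prod,
      Polynomial.eval_pow, Polynomial.eval_X, Polynomial.eval_zero] at hk
  rw [Finset.prod_eq_zero (Finset.mem_univ k) (by simp), mul_zero, sub_zero,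
    Finset.sum_eq_single k] at hk
  · have hck : c k = 0 := by
      rcases mul_eq_zero.mp hk with h1 | h1
      · exact h1
      · exfalso
        obtain ⟨j, hj, hj2⟩ := Finset.prod_eq_zero_iff.mp h1
        have h3 := sub_eq_zero.mp (pow_eq_zero_iff (two_ne_zero)|>.mp hj2)
        exact (Finset.mem_erase.mp hj).1 (hwi h3).symm
    exact ⟨congrArg Complex.re hck, congrArg Complex.im hck⟩
  · intro i _ hik
    rw [Finset.prod_eq_zero (Finset.mem_erase.mpr ⟨hik.symm, Finset.mem_univ k⟩) (by simp), mul_zero]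
  · simp
end

section
/- Let N ≥ 1 be a finite integer, let X_k = (x_k, y_k), k = 1, ..., N, be distinct points of ℝ² with 0 < |X_k| < 1, and let a_1, ..., a_N, b_1, ..., b_N be real numbers. Define the third-order multipole basis functions 𝔸_k(X) = 2(x − x_k)[3(y − y_k)² − (x − x_k)²]/|X − X_k|⁶ and 𝔹_k(X) = 2(y − y_k)[3(x − x_k)² − (y − y_k)²]/|X − X_k|⁶. If Σ_{k=1}^{N} (a_k 𝔸_k(X) + b_k 𝔹_k(X)) = 0 for every X = (x, y) ∈ ℝ² with |X| ≥ 1, then a_k = 0 and b_k = 0 for every k. -/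
/-- The real part identity behind the multipole functions. -/
theorem multipole_re (a b u v : ℝ) :
    a * (2 * u * (3 * v ^ 2 - u ^ 2) / (u ^ 2 + v ^ 2) ^ 3)
      + b * (2 * v * (3 * u ^ 2 - v ^ 2) / (u ^ 2 + v ^ 2) ^ 3)
      = ((⟨-2 * a, 2 * b⟩ : ℂ) / (⟨u, v⟩ : ℂ) ^ 3).re := by
  have h1 : Complex.normSq ((⟨u, v⟩ : ℂ) ^ 3) = (u ^ 2 + v ^ 2) ^ 3 := by
    rw [map_pow, Complex.normSq_mk]; ring
  rw [Complex.div_re, h1]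
  have h2 : ((⟨u, v⟩ : ℂ) ^ 3).re = u ^ 3 - 3 * u * v ^ 2 := by
    simp [pow_succ]; ring
  have h3 : ((⟨u, v⟩ : ℂ) ^ 3).im = 3 * u ^ 2 * v - v ^ 3 := by
    simp [pow_succ]; ring
  rw [h2, h3]
  ring

/-- A constant combination of third order poles on an infinite set has zero coefficients. -/
theorem poles_coeff_zero {N : ℕ} (q : Fin N → ℂ) (hq : Function.Injective q) (c : Fin N → ℂ)
    (w : ℂ) (U : Set ℂ) (hU : U.Infinite) (hne : ∀ z ∈ U, ∀ k, z - q k ≠ 0)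
    (h : ∀ z ∈ U, ∑ k, c k / (z - q k) ^ 3 = w) : ∀ k, c k = 0 := by
  classical
  let P : Polynomial ℂ :=
    ∑ k, Polynomial.C (c k) * ∏ j ∈ Finset.univ.erase k, (Polynomial.X - Polynomial.C (q j)) ^ 3
  let Q : Polynomial ℂ :=
    Polynomial.C w * ∏ j, (Polynomial.X - Polynomial.C (q j)) ^ 3
  have hPQ : P = Q := by
    apply Polynomial.eq_of_infinite_eval_eq
    refine hU.mono fun z hz => ?_
    simp only [Set.mem_setOf_eq, P, Q, Polynomial.eval_finset_sum, Polynomial.eval_mul,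
      Polynomial.eval_C, Polynomial.eval_prod, Polynomial.eval_pow, Polynomial.eval_sub,
      Polynomial.eval_X]
    rw [← h z hz, Finset.sum_mul]
    refine Finset.sum_congr rfl fun k _ => ?_
    rw [← Finset.mul_prod_erase Finset.univ _ (Finset.mem_univ k)]
    have := hne z hz k
    field_simp
  intro m
  have he := congrArg (Polynomial.eval (q m)) hPQ
  simp only [P, Q, Polynomial.eval_finset_sum, Polynomial.eval_mul,
      Polynomial.eval_C, Polynomial.eval_prod, Polynomial.eval_pow, Polynomial.eval_sub,
      Polynomial.eval_X] at he
  rw [Finset.sum_eq_single m, Finset.prod_eq_zero (Finset.mem_univ m) (by simp), mul_zero,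
    mul_eq_zero] at he
  · refine he.resolve_right (Finset.prod_ne_zero_iff.mpr fun j hj => ?_)
    exact pow_ne_zero _ (sub_ne_zero.mpr fun hh => (Finset.ne_of_mem_erase hj) (hq hh).symm)
  · intro k _ hk
    rw [Finset.prod_eq_zero (Finset.mem_erase.mpr ⟨hk.symm, Finset.mem_univ m⟩) (by simp),
      mul_zero]
  · simp

/-- Uniqueness of third-order multipole expansions in `ℝ²`: if a finite linear
combination of `𝔸_k(X) = 2(x - x_k)[3(y - y_k)² - (x - x_k)²]/‖X - X_k‖⁶` and
`𝔹_k(X) = 2(y - y_k)[3(x - x_k)² - (y - y_k)²]/‖X - X_k‖⁶` vanishes for all `‖X‖ ≥ 1`,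
then all coefficients vanish. -/
theorem third_order_multipole_expansion_unique_R2 (N : ℕ) (hN : 1 ≤ N)
    (p : Fin N → ℝ × ℝ) (hp : Function.Injective p)
    (hp1 : ∀ k, 0 < (p k).1 ^ 2 + (p k).2 ^ 2 ∧ (p k).1 ^ 2 + (p k).2 ^ 2 < 1)
    (a b : Fin N → ℝ)
    (h : ∀ x y : ℝ, 1 ≤ x ^ 2 + y ^ 2 →
      ∑ k, (a k * (2 * (x - (p k).1) * (3 * (y - (p k).2) ^ 2 - (x - (p k).1) ^ 2)
              / ((x - (p k).1) ^ 2 + (y - (p k).2) ^ 2) ^ 3)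
          + b k * (2 * (y - (p k).2) * (3 * (x - (p k).1) ^ 2 - (y - (p k).2) ^ 2)
              / ((x - (p k).1) ^ 2 + (y - (p k).2) ^ 2) ^ 3)) = 0) :
    ∀ k, a k = 0 ∧ b k = 0 := by
  let q : Fin N → ℂ := fun k => ⟨(p k).1, (p k).2⟩
  let c : Fin N → ℂ := fun k => ⟨-2 * a k, 2 * b k⟩
  let U : Set ℂ := Metric.ball 3 1
  have hq : Function.Injective q := by
    intro i j hij
    apply hp
    exact Prod.ext (congrArg Complex.re hij) (congrArg Complex.im hij)
  have hre : ∀ z ∈ U, 1 < z.re := by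
    intro z hz
    have h1 : ‖z - 3‖ < 1 := by simpa [U, dist_eq_norm] using hz
    have h2 := (abs_le.mp (Complex.abs_re_le_norm (z - 3))).1
    simp at h2
    linarith
  have hne : ∀ z ∈ U, ∀ k, z - q k ≠ 0 := by
    intro z hz k h0
    have h1 := hre z hz
    have h2 : z.re = (p k).1 := congrArg Complex.re (sub_eq_zero.mp h0)
    have h3 := (hp1 k).2
    nlinarith [sq_nonneg (p k).2]
  have hf0 : ∀ z ∈ U, (∑ k, c k / (z - q k) ^ 3).re = 0 := by
    intro z hz
    have h1 := hre z hz
    rw [← h z.re z.im (by nlinarith [sq_nonneg z.im]), Complex.re_sum]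
    refine Finset.sum_congr rfl fun k _ => ?_
    rw [multipole_re]
    rfl
  have hd : DifferentiableOn ℂ (fun z => ∑ k, c k / (z - q k) ^ 3) U := by
    refine DifferentiableOn.fun_sum fun k _ => ?_
    refine DifferentiableOn.div (by fun_prop) (by fun_prop) fun z hz => pow_ne_zero _ (hne z hz k)
  have hconn : IsConnected U :=
    (convex_ball (3 : ℂ) 1).isConnected ⟨3, Metric.mem_ball_self one_pos⟩
  obtain ⟨t, ht⟩ := (hd.analyticOnNhd Metric.isOpen_ball).eq_re_add_const_mul_I_of_re_eq_const
    hf0 Metric.isOpen_ball hconn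
  have hinf : U.Infinite :=
    infinite_of_mem_nhds (3 : ℂ) (Metric.ball_mem_nhds _ one_pos)
  have hc := poles_coeff_zero q hq c _ U hinf hne (fun z hz => ht z hz)
  intro k
  have h1 : -2 * a k = 0 := congrArg Complex.re (hc k)
  have h2 : 2 * b k = 0 := congrArg Complex.im (hc k)
  constructor <;> linarith
end

section
/- Let N ≥ 1 be a finite integer, let X_1, ..., X_N be distinct points of ℝ³ with 0 < |X_k| < 1 for every k, and let m_1, ..., m_N be real numbers. If V(X) = Σ_{k=1}^{N} m_k / |X − X_k| satisfies V(X) = 0 for every X ∈ ℝ³ with |X| ≥ 1, then m_k = 0 for every k. -/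
/-- Uniqueness of point-mass expansions in `ℝ³`: if `V(X) = Σ m_k / ‖X - X_k‖`
vanishes for all `‖X‖ ≥ 1`, then all `m_k = 0`. -/
theorem point_mass_expansion_unique_R3 (N : ℕ) (hN : 1 ≤ N)
    (X : Fin N → EuclideanSpace ℝ (Fin 3)) (hX : Function.Injective X)
    (hX1 : ∀ k, 0 < ‖X k‖ ∧ ‖X k‖ < 1)
    (m : Fin N → ℝ)
    (h : ∀ P : EuclideanSpace ℝ (Fin 3), 1 ≤ ‖P‖ → ∑ k, m k / ‖P - X k‖ = 0) :
    ∀ k, m k = 0 := by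
  intro k
  have han : AnalyticOnNhd ℝ (fun P => ∑ k, m k / ‖P - X k‖) (Set.range X)ᶜ := by
    intro P hP
    have hne : ∀ j, P - X j ≠ 0 := fun j hj => hP ⟨j, (sub_eq_zero.mp hj).symm⟩
    refine Finset.analyticAt_fun_sum _ fun j _ => ?_
    refine AnalyticAt.div analyticAt_const ?_ (norm_ne_zero_iff.mpr (hne j))
    have h1 : ContDiffAt ℝ (⊤ : WithTop ℕ∞) (fun Q : EuclideanSpace ℝ (Fin 3) => ‖Q - X j‖) P :=
      (contDiffAt_id.sub contDiffAt_const).norm ℝ (hne j)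
    exact h1.analyticAt
  have hconn : IsPreconnected (Set.range X)ᶜ := by
    refine ((Set.finite_range X).countable.isPathConnected_compl_of_one_lt_rank
      ?_).isConnected.isPreconnected
    rw [← Module.finrank_eq_rank]
    simp only [finrank_euclideanSpace, Fintype.card_fin]
    norm_num
  obtain ⟨P₀, hP₀⟩ : ∃ P : EuclideanSpace ℝ (Fin 3), ‖P‖ = 2 :=
    exists_norm_eq _ (by norm_num)
  have hmem : P₀ ∈ (Set.range X)ᶜ := by
    rintro ⟨j, rfl⟩
    linarith [(hX1 j).2]
  have hev : (fun P => ∑ k, m k / ‖P - X k‖) =ᶠ[nhds P₀] 0 := by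
    have : ∀ᶠ P : EuclideanSpace ℝ (Fin 3) in nhds P₀, 1 < ‖P‖ :=
      continuous_norm.continuousAt.eventually (lt_mem_nhds (by simp only [hP₀]; norm_num))
    filter_upwards [this] with P hP using h P hP.le
  have hz := han.eqOn_zero_of_preconnected_of_eventuallyEq_zero hconn hmem hev
  have hcont : ContinuousAt (fun P => m k + ‖P - X k‖ *
      ∑ j ∈ Finset.univ.erase k, m j / ‖P - X j‖) (X k) := by
    refine continuousAt_const.add (ContinuousAt.mul (by fun_prop) ?_)
    refine tendsto_finsetSum _ fun j hj => ?_
    have hne : ‖X k - X j‖ ≠ 0 := by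
      rw [norm_ne_zero_iff, sub_ne_zero]
      exact fun e => (Finset.ne_of_mem_erase hj) (hX e).symm
    exact ContinuousAt.div continuousAt_const (by fun_prop) hne
  have hlim := hcont.tendsto.mono_left (nhdsWithin_le_nhds (s := {X k}ᶜ))
  have hopen : ∀ᶠ P in nhds (X k), P ∉ X '' {j | j ≠ k} :=
    ((Set.toFinite (X '' {j | j ≠ k})).isClosed.isOpen_compl).mem_nhds
      (by rintro ⟨j, hj, e⟩; exact hj (hX e))
  have hzero : ∀ᶠ P in nhdsWithin (X k) {X k}ᶜ, m k + ‖P - X k‖ *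
      ∑ j ∈ Finset.univ.erase k, m j / ‖P - X j‖ = 0 := by
    filter_upwards [nhdsWithin_le_nhds hopen, self_mem_nhdsWithin] with P hP hPk
    have hPm : P ∈ (Set.range X)ᶜ := by
      rintro ⟨j, rfl⟩
      by_cases hj : j = k
      · exact hPk (by rw [hj]; rfl)
      · exact hP ⟨j, hj, rfl⟩
    have hs := hz hPm
    have hn : ‖P - X k‖ ≠ 0 := by
      rw [norm_ne_zero_iff, sub_ne_zero]; exact hPk
    simp only [Pi.zero_apply] at hs
    rw [← Finset.add_sum_erase _ _ (Finset.mem_univ k)] at hs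
    have := congrArg (fun t => ‖P - X k‖ * t) hs
    simp only [mul_add, mul_zero] at this
    rwa [mul_div_cancel₀ _ hn] at this
  have h0 := tendsto_nhds_unique hlim
    (tendsto_const_nhds.congr' (hzero.mono fun P hP => hP.symm))
  simpa using h0
end

section
/- Let N ≥ 1 be a finite integer, let X_1, ..., X_N be distinct points of ℝ³ with 0 < |X_k| < 1 for every k, and let D_1, ..., D_N be vectors in ℝ³. If W(X) = Σ_{k=1}^{N} D_k · ∇_X (1/|X − X_k|) satisfies W(X) = 0 for every X ∈ ℝ³ with |X| ≥ 1, then D_k = 0 for every k. -/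
open RealInnerProductSpace

lemma dip_grad (X D P : EuclideanSpace ℝ (Fin 3)) (hP : P ≠ X) :
    ⟪D, gradient (fun P' : EuclideanSpace ℝ (Fin 3) => 1 / ‖P' - X‖) P⟫
      = -(⟪D, P - X⟫ * (‖P - X‖ ^ 3)⁻¹) := by
  have hne : P - X ≠ 0 := sub_ne_zero.mpr hP
  have hn : ‖P - X‖ ≠ 0 := norm_ne_zero_iff.mpr hne
  have hd : DifferentiableAt ℝ (fun P' : EuclideanSpace ℝ (Fin 3) => ‖P' - X‖) P :=
    (differentiableAt_id.sub_const X).norm ℝ hne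
  have h1 := hd.hasFDerivAt
  have h2 := h1.pow 2
  have h3 : HasFDerivAt (fun P' : EuclideanSpace ℝ (Fin 3) => ‖P' - X‖ ^ 2) _ P :=
    ((hasFDerivAt_id P).sub_const X).norm_sq
  have h4 := congrArg (fun L => L D) (h2.unique h3)
  have h5 : HasFDerivAt (fun P' : EuclideanSpace ℝ (Fin 3) => (‖P' - X‖)⁻¹) _ P :=
    (hasDerivAt_inv hn).comp_hasFDerivAt P h1
  have h6 : (fun P' : EuclideanSpace ℝ (Fin 3) => 1 / ‖P' - X‖)
      = (fun P' : EuclideanSpace ℝ (Fin 3) => (‖P' - X‖)⁻¹) := by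
    funext; simp
  rw [h6, real_inner_comm, gradient, InnerProductSpace.toDual_symm_apply, h5.fderiv]
  simp at h4 ⊢
  rw [real_inner_comm] at h4
  field_simp
  rw [inner_sub_right, real_inner_comm X D]
  linarith

lemma dip_analytic (X D P : EuclideanSpace ℝ (Fin 3)) (hP : P ≠ X) :
    AnalyticAt ℝ (fun P => -(⟪D, P - X⟫ * (‖P - X‖ ^ 3)⁻¹)) P := by
  have hne : P - X ≠ 0 := sub_ne_zero.mpr hP
  have hn : ‖P - X‖ ^ 3 ≠ 0 := pow_ne_zero _ (norm_ne_zero_iff.mpr hne)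
  have hs : ContDiffAt ℝ ⊤ (fun P : EuclideanSpace ℝ (Fin 3) => P - X) P :=
    contDiffAt_id.sub contDiffAt_const
  have : ContDiffAt ℝ ⊤ (fun P => -(⟪D, P - X⟫ * (‖P - X‖ ^ 3)⁻¹)) P :=
    ((contDiffAt_const.inner ℝ hs).mul (((hs.norm ℝ hne).pow 3).inv hn)).neg
  exact this.analyticAt

/-- Uniqueness of point-dipole expansions in `ℝ³`: if
`W(X) = Σ D_k · ∇(1/‖X - X_k‖)` vanishes for all `‖X‖ ≥ 1`, then all `D_k = 0`. -/
theorem point_dipole_expansion_unique_R3 (N : ℕ) (hN : 1 ≤ N)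
    (X : Fin N → EuclideanSpace ℝ (Fin 3)) (hX : Function.Injective X)
    (hX1 : ∀ k, 0 < ‖X k‖ ∧ ‖X k‖ < 1)
    (D : Fin N → EuclideanSpace ℝ (Fin 3))
    (h : ∀ P : EuclideanSpace ℝ (Fin 3), 1 ≤ ‖P‖ →
      ∑ k, ⟪D k, gradient (fun P' : EuclideanSpace ℝ (Fin 3) => 1 / ‖P' - X k‖) P⟫ = 0) :
    ∀ k, D k = 0 := by
  classical
  set f : Fin N → EuclideanSpace ℝ (Fin 3) → ℝ :=
    fun k P => -(⟪D k, P - X k⟫ * (‖P - X k‖ ^ 3)⁻¹) with hf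
  have hconn : IsPreconnected (Set.range X)ᶜ :=
    ((Set.finite_range X).countable.isPathConnected_compl_of_one_lt_rank (by
      rw [← Module.finrank_eq_rank]; simp)).isConnected.isPreconnected
  have han : AnalyticOnNhd ℝ (fun P => ∑ k, f k P) (Set.range X)ᶜ := by
    intro P hP
    have := Finset.analyticAt_fun_sum (𝕜 := ℝ) (f := f) (c := P) Finset.univ
      (fun k _ => dip_analytic (X k) (D k) P (fun e => hP ⟨k, e.symm⟩))
    exact this
  obtain ⟨P0, hP0⟩ : ∃ P : EuclideanSpace ℝ (Fin 3), ‖P‖ = 2 := 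
    ⟨EuclideanSpace.single 0 2, by simp⟩
  have hout : ∀ P : EuclideanSpace ℝ (Fin 3), 1 ≤ ‖P‖ → ∀ k, P ≠ X k := by
    intro P hP k e
    have := (hX1 k).2
    rw [← e] at this; linarith
  have hz : Set.EqOn (fun P => ∑ k, f k P) 0 (Set.range X)ᶜ := by
    refine han.eqOn_zero_of_preconnected_of_eventuallyEq_zero hconn (z₀ := P0) ?_ ?_
    · rintro ⟨k, hk⟩
      exact hout P0 (by linarith) k hk.symm
    · have : ∀ᶠ P in nhds P0, 1 < ‖P‖ :=
        continuous_norm.continuousAt.eventually (lt_mem_nhds (by simp [hP0]))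
      filter_upwards [this] with P hP
      have h' := h P hP.le
      rw [Finset.sum_congr rfl (fun k _ => dip_grad (X k) (D k) P (hout P hP.le k))] at h'
      exact h'
  intro j
  by_contra hj
  have hjn : ‖D j‖ ≠ 0 := norm_ne_zero_iff.mpr hj
  let γ : ℝ → EuclideanSpace ℝ (Fin 3) := fun t => X j + t • D j
  have hγ : Continuous γ := by fun_prop
  have hγ0 : γ 0 = X j := by simp [γ]
  have hcont : ContinuousAt (fun t => ∑ k ∈ Finset.univ.erase j, f k (γ t)) 0 := by
    refine tendsto_finsetSum _ fun k hk => ?_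
    have hkj : X j ≠ X k := fun e => (Finset.ne_of_mem_erase hk) (hX e).symm
    have h1 : ContinuousAt (f k) (γ 0) := by
      rw [hγ0]; exact (dip_analytic (X k) (D k) (X j) hkj).continuousAt
    exact h1.comp hγ.continuousAt
  have hlim2 : Filter.Tendsto
      (fun t : ℝ => t ^ 2 * ∑ k ∈ Finset.univ.erase j, f k (γ t)) (nhdsWithin 0 (Set.Ioi 0)) (nhds 0) := by
    have h1 : ContinuousAt (fun t : ℝ => t ^ 2 * ∑ k ∈ Finset.univ.erase j, f k (γ t)) 0 :=
      ContinuousAt.mul (by fun_prop) hcont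
    have := h1.tendsto
    simp only [ne_eq, OfNat.ofNat_ne_zero, not_false_eq_true, zero_pow, zero_mul] at this
    exact this.mono_left nhdsWithin_le_nhds
  have hev : ∀ᶠ t in nhdsWithin (0:ℝ) (Set.Ioi 0), ∀ k, k ≠ j → γ t ≠ X k := by
    refine Filter.Eventually.filter_mono nhdsWithin_le_nhds ?_
    rw [Filter.eventually_all]
    intro k
    by_cases hk : k = j
    · simp [hk]
    · have : γ 0 ≠ X k := by rw [hγ0]; exact fun e => hk (hX e).symm
      filter_upwards [hγ.continuousAt.eventually_ne this] with t ht _ using ht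
  have heq : (fun t : ℝ => t ^ 2 * ∑ k ∈ Finset.univ.erase j, f k (γ t))
      =ᶠ[nhdsWithin 0 (Set.Ioi 0)] fun _ => ‖D j‖⁻¹ := by
    filter_upwards [hev, self_mem_nhdsWithin] with t ht ht0
    have ht0 : 0 < t := ht0
    have hmem : γ t ∈ (Set.range X)ᶜ := by
      rintro ⟨k, hk⟩
      by_cases hkj : k = j
      · subst hkj
        have : t • D k = 0 := by simpa [γ] using hk
        exact (smul_ne_zero ht0.ne' hj) this
      · exact ht k hkj hk.symm
    have h0 : ∑ k, f k (γ t) = 0 := hz hmem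
    rw [← Finset.add_sum_erase _ _ (Finset.mem_univ j)] at h0
    have h1 : f j (γ t) = -(t * ‖D j‖ ^ 2 * ((t * ‖D j‖) ^ 3)⁻¹) := by
      simp only [hf, γ, add_sub_cancel_left, inner_smul_right, real_inner_self_eq_norm_sq,
        norm_smul, Real.norm_eq_abs, abs_of_pos ht0]
    have h2 : ∑ k ∈ Finset.univ.erase j, f k (γ t) = t * ‖D j‖ ^ 2 * ((t * ‖D j‖) ^ 3)⁻¹ := by
      linarith
    rw [h2]
    field_simp
  have := tendsto_nhds_unique (hlim2.congr' heq) tendsto_const_nhds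
  exact inv_ne_zero hjn this.symm
end
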